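/- arXiv:1703.03955 — 2 statements merged into one kernel-verified Lean document; each statement's English description precedes it below -/
import Mathlib

section
/- Let n ≥ 1 and W = S_{n+1}, and let w₀ be the longest element (w₀(k) = n+2−k). Let V = {w₀} ∪ {w ∈ W : w⁻¹(1) < w⁻¹(2) and w⁻¹(2) > w⁻¹(3) > ⋯ > w⁻¹(n+1)}. Then V has exactly n+1 elements and is totally ordered by the Bruhat order. The same conclusions hold for the set {w₀} ∪ {w ∈ W : w⁻¹(1) > w⁻¹(2) > ⋯ > w⁻¹(n) and w⁻¹(n) < w⁻¹(n+1)}. -/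
/-- The number of inversions (Coxeter length) of a permutation of `Fin m`. -/
def sLen {m : ℕ} (w : Equiv.Perm (Fin m)) : ℕ :=
  (Finset.univ.filter fun p : Fin m × Fin m => p.1 < p.2 ∧ w p.2 < w p.1).card

/-- The Bruhat order on the symmetric group: generated by `w < t * w` for a
transposition `t` with `sLen (t * w) > sLen w`. -/
def bruhatLE {m : ℕ} (u v : Equiv.Perm (Fin m)) : Prop :=
  Relation.ReflTransGen
    (fun x y => (∃ a b : Fin m, a ≠ b ∧ y = Equiv.swap a b * x) ∧ sLen x < sLen y) u v

/-- The right descent set of `w`, as a set of indices of simple reflections: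
`i : Fin n` stands for the simple transposition `s_{i+1} = (i+1, i+2)` (1-based). -/
def Des {n : ℕ} (w : Equiv.Perm (Fin (n + 1))) : Set (Fin n) :=
  {i | w i.succ < w i.castSucc}

/-- Maximal-length double-coset representatives:
`X⁺_{I,J} = {w : I ⊆ Des (w⁻¹) ∧ J ⊆ Des w}`. -/
def Xplus {n : ℕ} (I J : Set (Fin n)) : Set (Equiv.Perm (Fin (n + 1))) :=
  {w | I ⊆ Des w⁻¹ ∧ J ⊆ Des w}

/-- A subset of the symmetric group is totally ordered (a chain) in Bruhat order. -/
def IsChainOn {m : ℕ} (X : Set (Equiv.Perm (Fin m))) : Prop :=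
  ∀ x ∈ X, ∀ y ∈ X, bruhatLE x y ∨ bruhatLE y x

/-- A subset of the symmetric group, with the restriction of the Bruhat order,
is a lattice: every pair has a least upper bound and a greatest lower bound in the set. -/
def IsLatticeOn {m : ℕ} (X : Set (Equiv.Perm (Fin m))) : Prop :=
  (∀ x ∈ X, ∀ y ∈ X, ∃ z ∈ X, bruhatLE x z ∧ bruhatLE y z ∧
      ∀ t ∈ X, bruhatLE x t → bruhatLE y t → bruhatLE z t) ∧
  (∀ x ∈ X, ∀ y ∈ X, ∃ z ∈ X, bruhatLE z x ∧ bruhatLE z y ∧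
      ∀ t ∈ X, bruhatLE t x → bruhatLE t y → bruhatLE t z)

/-- `y` covers `x` in the restriction of the Bruhat order to `X`. -/
def CoversIn {m : ℕ} (X : Set (Equiv.Perm (Fin m))) (x y : Equiv.Perm (Fin m)) : Prop :=
  x ∈ X ∧ y ∈ X ∧ bruhatLE x y ∧ x ≠ y ∧
    ∀ z ∈ X, bruhatLE x z → bruhatLE z y → z = x ∨ z = y

/-- Multiplying on the right by an adjacent transposition at an ascent increases the length. -/
theorem sLen_lt_sLen_mul_swap {n : ℕ} (w : Equiv.Perm (Fin (n + 1))) (k : Fin n)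
    (h : w k.castSucc < w k.succ) :
    sLen w < sLen (w * Equiv.swap k.castSucc k.succ) := by
  set s := Equiv.swap k.castSucc k.succ with hs
  have s_lt : ∀ a b : Fin (n + 1), a < b → ¬ (a = k.castSucc ∧ b = k.succ) → s a < s b := by
    intro a b hab hne
    simp only [hs, Equiv.swap_apply_def]
    simp only [Fin.ext_iff, Fin.lt_def, Fin.val_castSucc, Fin.val_succ] at hab hne ⊢
    split_ifs <;> (try simp only [Fin.val_castSucc, Fin.val_succ]) <;> omega
  unfold sLen
  rw [← Finset.card_map (s.prodCongr s).toEmbedding]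
  apply Finset.card_lt_card
  rw [Finset.ssubset_iff_of_subset]
  · refine ⟨(k.castSucc, k.succ), ?_, ?_⟩
    · simpa [hs] using h
    · simp only [Finset.mem_map, Finset.mem_filter, Finset.mem_univ, true_and, not_exists, not_and,
        Prod.forall]
      rintro a b ⟨hab, hw⟩ heq
      simp only [Equiv.coe_toEmbedding, Equiv.prodCongr_apply, Prod.map_apply,
        Prod.mk.injEq] at heq
      have ha : a = k.succ := s.injective (heq.1.trans (by simp [hs]))
      have hb : b = k.castSucc := s.injective (heq.2.trans (by simp [hs]))
      subst ha hb
      exact absurd hab (by simp [Fin.lt_def])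
  · rintro ⟨c, d⟩ hcd
    simp only [Finset.mem_map, Finset.mem_filter, Finset.mem_univ, true_and, Prod.exists] at hcd ⊢
    obtain ⟨a, b, ⟨hab, hw⟩, heq⟩ := hcd
    simp only [Equiv.coe_toEmbedding, Equiv.prodCongr_apply, Prod.map_apply,
      Prod.mk.injEq] at heq
    obtain ⟨rfl, rfl⟩ := heq
    refine ⟨s_lt a b hab ?_, by simpa [hs] using hw⟩
    rintro ⟨rfl, rfl⟩
    exact lt_asymm h hw

theorem bruhatLE_mul_swap {n : ℕ} (w : Equiv.Perm (Fin (n + 1))) (k : Fin n)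
    (h : w k.castSucc < w k.succ) :
    bruhatLE w (w * Equiv.swap k.castSucc k.succ) :=
  .single ⟨⟨w k.castSucc, w k.succ, h.ne, Equiv.mul_swap_eq_swap_mul _ _ _⟩,
    sLen_lt_sLen_mul_swap w k h⟩

/-- The permutation whose inverse sends `p` to `k` and is decreasing on the complement of `p`. -/
def antiPerm {n : ℕ} (p k : Fin (n + 1)) : Equiv.Perm (Fin (n + 1)) :=
  (finSuccEquiv' k).trans ((Equiv.optionCongr Fin.revPerm).trans (finSuccEquiv' p).symm)

theorem antiPerm_inv_self {n : ℕ} (p k : Fin (n + 1)) : (antiPerm p k)⁻¹ p = k := by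
  rw [Equiv.Perm.inv_eq_iff_eq]
  simp [antiPerm]

theorem antiPerm_apply_self {n : ℕ} (p k : Fin (n + 1)) : antiPerm p k k = p := by
  simp [antiPerm]

theorem antiPerm_inv_succAbove {n : ℕ} (p k : Fin (n + 1)) (i : Fin n) :
    (antiPerm p k)⁻¹ (p.succAbove i) = k.succAbove i.rev := by
  rw [Equiv.Perm.inv_eq_iff_eq]
  simp [antiPerm]

theorem antiPerm_injective {n : ℕ} (p : Fin (n + 1)) : Function.Injective (antiPerm p) := by
  intro k l h
  rw [← antiPerm_inv_self p k, h, antiPerm_inv_self]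

theorem range_comp_succAbove {n : ℕ} (u : Equiv.Perm (Fin (n + 1))) (p : Fin (n + 1)) :
    Set.range (u ∘ p.succAbove) = {u p}ᶜ := by
  rw [Set.range_comp, Fin.range_succAbove, Set.image_compl_eq u.bijective, Set.image_singleton]

theorem strictAnti_antiPerm_inv {n : ℕ} (p k : Fin (n + 1)) :
    StrictAnti (⇑(antiPerm p k)⁻¹ ∘ p.succAbove) := by
  intro i j hij
  simp only [Function.comp_apply, antiPerm_inv_succAbove]
  exact Fin.strictMono_succAbove k (Fin.rev_lt_rev.mpr hij)

theorem mem_range_antiPerm_iff {n : ℕ} (p : Fin (n + 1)) (w : Equiv.Perm (Fin (n + 1))) :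
    w ∈ Set.range (antiPerm p) ↔ StrictAnti (⇑w⁻¹ ∘ p.succAbove) := by
  refine ⟨?_, fun h => ⟨w⁻¹ p, ?_⟩⟩
  · rintro ⟨k, rfl⟩
    exact strictAnti_antiPerm_inv p k
  · have key := ((strictAnti_antiPerm_inv p (w⁻¹ p)).range_inj h).mp
      (by rw [range_comp_succAbove, range_comp_succAbove, antiPerm_inv_self])
    refine inv_injective (Equiv.ext fun i => ?_)
    rcases eq_or_ne i p with rfl | hi
    · exact antiPerm_inv_self _ _
    · obtain ⟨j, rfl⟩ := Fin.exists_succAbove_eq hi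
      exact congrFun key j

theorem antiPerm_succ {n : ℕ} (p : Fin (n + 1)) (k : Fin n) :
    antiPerm p k.succ = antiPerm p k.castSucc * Equiv.swap k.castSucc k.succ := by
  refine inv_injective (Equiv.ext fun i => ?_)
  rw [mul_inv_rev, Equiv.swap_inv, Equiv.Perm.mul_apply]
  rcases eq_or_ne i p with rfl | hi
  · simp [antiPerm_inv_self]
  · obtain ⟨j, rfl⟩ := Fin.exists_succAbove_eq hi
    rw [antiPerm_inv_succAbove, antiPerm_inv_succAbove]
    generalize j.rev = r
    rcases eq_or_ne r k with rfl | hr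
    · simp
    · have hr' : (r : ℕ) ≠ k := Fin.val_ne_of_ne hr
      rw [Equiv.swap_apply_def]
      simp only [Fin.succAbove, Fin.ext_iff, Fin.lt_def, Fin.val_castSucc, Fin.val_succ]
      split_ifs <;> simp only [Fin.val_castSucc, Fin.val_succ] at * <;> omega

theorem isChainOn_range_of_succ {n m : ℕ} {f : Fin (n + 1) → Equiv.Perm (Fin m)}
    (hf : ∀ k : Fin n, bruhatLE (f k.castSucc) (f k.succ)) : IsChainOn (Set.range f) := by
  have : IsTrans (Equiv.Perm (Fin m)) bruhatLE := ⟨fun _ _ _ => Relation.ReflTransGen.trans⟩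
  have hlt := (Fin.liftFun_iff_succ bruhatLE (f := f)).mpr hf
  rintro _ ⟨i, rfl⟩ _ ⟨j, rfl⟩
  rcases lt_trichotomy i j with h | rfl | h
  · exact .inl (hlt h)
  · exact .inl .refl
  · exact .inr (hlt h)

theorem isChainOn_range_of_succ' {n m : ℕ} {f : Fin (n + 1) → Equiv.Perm (Fin m)}
    (hf : ∀ k : Fin n, bruhatLE (f k.succ) (f k.castSucc)) : IsChainOn (Set.range f) := by
  rw [← Fin.rev_surjective.range_comp f]
  refine isChainOn_range_of_succ fun k => ?_
  simpa [Fin.rev_castSucc, Fin.rev_succ] using hf k.rev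

theorem isChainOn_range_antiPerm_zero (n : ℕ) :
    IsChainOn (Set.range (antiPerm (0 : Fin (n + 1)))) := by
  refine isChainOn_range_of_succ fun k => ?_
  rw [antiPerm_succ]
  refine bruhatLE_mul_swap _ k ?_
  rw [antiPerm_apply_self, Fin.pos_iff_ne_zero, Ne, ← Equiv.Perm.eq_inv_iff_eq, antiPerm_inv_self]
  exact k.castSucc_lt_succ.ne'

theorem isChainOn_range_antiPerm_last (n : ℕ) :
    IsChainOn (Set.range (antiPerm (Fin.last n))) := by
  refine isChainOn_range_of_succ' fun k => ?_
  have h : antiPerm (Fin.last n) k.castSucc =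
      antiPerm (Fin.last n) k.succ * Equiv.swap k.castSucc k.succ := by
    rw [antiPerm_succ, mul_assoc, Equiv.swap_mul_self, mul_one]
  rw [h]
  refine bruhatLE_mul_swap _ k ?_
  rw [antiPerm_apply_self, Fin.lt_last_iff_ne_last, Ne, ← Equiv.Perm.eq_inv_iff_eq,
    antiPerm_inv_self]
  exact k.castSucc_lt_succ.ne

theorem ncard_range_antiPerm {n : ℕ} (p : Fin (n + 1)) :
    (Set.range (antiPerm p)).ncard = n + 1 := by
  rw [← Set.image_univ, Set.ncard_image_of_injective _ (antiPerm_injective p), Set.ncard_univ,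
    Nat.card_fin]

theorem eq_revPerm_iff_strictAnti_inv {n : ℕ} (w : Equiv.Perm (Fin n)) :
    w = Fin.revPerm ↔ StrictAnti ⇑w⁻¹ := by
  constructor
  · rintro rfl
    exact Fin.rev_strictAnti
  · intro h
    have := (h.range_inj Fin.rev_strictAnti).mp
      (by rw [w⁻¹.surjective.range_eq, Fin.rev_surjective.range_eq])
    exact inv_injective (Equiv.ext fun i => congrFun this i)

theorem range_antiPerm_zero (n : ℕ) :
    Set.range (antiPerm (0 : Fin (n + 2))) = {Fin.revPerm} ∪
      {w : Equiv.Perm (Fin (n + 2)) | w⁻¹ 0 < w⁻¹ 1 ∧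
        ∀ i : Fin (n + 1), 1 ≤ (i : ℕ) → w⁻¹ i.succ < w⁻¹ i.castSucc} := by
  ext w
  have hD : w ∈ Set.range (antiPerm 0) ↔
      ∀ i : Fin (n + 1), 1 ≤ (i : ℕ) → w⁻¹ i.succ < w⁻¹ i.castSucc := by
    rw [mem_range_antiPerm_iff, Fin.strictAnti_iff_succ_lt, Fin.forall_fin_succ (n := n)]
    simp
  rw [Set.mem_union, Set.mem_singleton_iff, Set.mem_ofPred_eq, ← hD, eq_revPerm_iff_strictAnti_inv]
  constructor
  · intro h
    rcases lt_or_ge (w⁻¹ 0) (w⁻¹ 1) with h01 | h01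
    · exact .inr ⟨h01, h⟩
    · refine .inl (Fin.strictAnti_iff_succ_lt.mpr ?_)
      rw [Fin.forall_fin_succ]
      exact ⟨h01.lt_of_ne (by simp), fun i => hD.mp h i.succ (by simp)⟩
  · rintro (h | h)
    · rw [mem_range_antiPerm_iff]
      exact h.comp_strictMono (Fin.strictMono_succAbove 0)
    · exact h.2

theorem range_antiPerm_last (n : ℕ) :
    Set.range (antiPerm (Fin.last (n + 1))) = {Fin.revPerm} ∪
      {w : Equiv.Perm (Fin (n + 2)) |
        (∀ i : Fin (n + 1), (i : ℕ) < n → w⁻¹ i.succ < w⁻¹ i.castSucc) ∧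
        w⁻¹ (Fin.last n).castSucc < w⁻¹ (Fin.last (n + 1))} := by
  ext w
  have hD : w ∈ Set.range (antiPerm (Fin.last (n + 1))) ↔
      ∀ i : Fin (n + 1), (i : ℕ) < n → w⁻¹ i.succ < w⁻¹ i.castSucc := by
    rw [mem_range_antiPerm_iff, Fin.strictAnti_iff_succ_lt, Fin.forall_fin_succ' (n := n)]
    simp
  rw [Set.mem_union, Set.mem_singleton_iff, Set.mem_ofPred_eq, ← hD, eq_revPerm_iff_strictAnti_inv]
  constructor
  · intro h
    rcases lt_or_ge (w⁻¹ (Fin.last n).castSucc) (w⁻¹ (Fin.last (n + 1))) with h01 | h01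
    · exact .inr ⟨h, h01⟩
    · refine .inl (Fin.strictAnti_iff_succ_lt.mpr ?_)
      rw [Fin.forall_fin_succ']
      refine ⟨fun i => hD.mp h i.castSucc (by simp), h01.lt_of_ne ?_⟩
      exact w⁻¹.injective.ne (Fin.castSucc_lt_last _).ne'
  · rintro (h | h)
    · rw [mem_range_antiPerm_iff]
      exact h.comp_strictMono (Fin.strictMono_succAbove _)
    · exact h.1

/-- Let `w₀` be the longest element of `S_{n+1}` (`w₀(k) = n+2−k`, i.e. `Fin.rev`
in 0-based terms).  The set `V = {w₀} ∪ {w : w⁻¹(1) < w⁻¹(2) > w⁻¹(3) > ⋯ > w⁻¹(n+1)}`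
has exactly `n+1` elements and is a chain in the Bruhat order; the same holds for
`{w₀} ∪ {w : w⁻¹(1) > ⋯ > w⁻¹(n) < w⁻¹(n+1)}`.  (Values and positions are 0-based.) -/
theorem stmt_4 (n : ℕ) (hn : 1 ≤ n) :
    (Set.ncard ({Fin.revPerm} ∪
        {w : Equiv.Perm (Fin (n + 1)) |
          w⁻¹ ⟨0, by omega⟩ < w⁻¹ ⟨1, by omega⟩ ∧
          ∀ i : Fin n, 1 ≤ (i : ℕ) → w⁻¹ i.succ < w⁻¹ i.castSucc}) = n + 1 ∧
      IsChainOn ({Fin.revPerm} ∪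
        {w : Equiv.Perm (Fin (n + 1)) |
          w⁻¹ ⟨0, by omega⟩ < w⁻¹ ⟨1, by omega⟩ ∧
          ∀ i : Fin n, 1 ≤ (i : ℕ) → w⁻¹ i.succ < w⁻¹ i.castSucc})) ∧
    (Set.ncard ({Fin.revPerm} ∪
        {w : Equiv.Perm (Fin (n + 1)) |
          (∀ i : Fin n, (i : ℕ) < n - 1 → w⁻¹ i.succ < w⁻¹ i.castSucc) ∧
          w⁻¹ ⟨n - 1, by omega⟩ < w⁻¹ ⟨n, by omega⟩}) = n + 1 ∧
      IsChainOn ({Fin.revPerm} ∪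
        {w : Equiv.Perm (Fin (n + 1)) |
          (∀ i : Fin n, (i : ℕ) < n - 1 → w⁻¹ i.succ < w⁻¹ i.castSucc) ∧
          w⁻¹ ⟨n - 1, by omega⟩ < w⁻¹ ⟨n, by omega⟩})) := by
  obtain ⟨m, rfl⟩ := Nat.exists_eq_add_of_le' hn
  have h₀ := range_antiPerm_zero m
  have h₁ := range_antiPerm_last m
  exact ⟨⟨h₀ ▸ ncard_range_antiPerm 0, h₀ ▸ isChainOn_range_antiPerm_zero (m + 1)⟩,
    ⟨h₁ ▸ ncard_range_antiPerm _, h₁ ▸ isChainOn_range_antiPerm_last (m + 1)⟩⟩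
end

section
/- Let n ≥ 5 and W = S_{n+1}. Let I = R − {s_2} and J = R − {s_2, s_q} with 3 < q < n, and let τ₀ be the minimal element of X⁺_{I,J} (namely τ₀ = (2, 1, n+1, n, ..., 3) in one-line notation). Then there is exactly one element τ₁ ∈ X⁺_{I,J} that covers τ₀ in the restriction of the Bruhat order to X⁺_{I,J}, i.e., exactly one τ₁ with τ₀ < τ₁ and no element of X⁺_{I,J} strictly between them. -/
/-- `w` is a shuffle of the words `1 0` and `m-1, m-2, ..., 2` (zero-based values) in which
the value `1` occupies position `i` and the value `0` occupies position `j`. -/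
structure IsShuffle {m : ℕ} (w : Equiv.Perm (Fin m)) (i j : Fin m) : Prop where
  map_one : (w i : ℕ) = 1
  map_zero : (w j : ℕ) = 0
  lt : i < j
  anti : ∀ a b, 2 ≤ (w a : ℕ) → w a < w b → b < a

lemma swap_lt_swap_of_adjacent {m : ℕ} {k l a b : Fin m} (hkl : (l : ℕ) = k + 1)
    (hab : a < b) (hne : ¬(a = k ∧ b = l)) : Equiv.swap k l a < Equiv.swap k l b := by
  simp only [Equiv.swap_apply_def, Fin.ext_iff, Fin.lt_def] at *
  split_ifs <;> omega

lemma sLen_mul_swap_lt {m : ℕ} {w : Equiv.Perm (Fin m)} {k l : Fin m}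
    (hkl : (l : ℕ) = k + 1) (hw : w l < w k) : sLen (w * Equiv.swap k l) < sLen w := by
  have hlt : k < l := by rw [Fin.lt_def]; omega
  unfold sLen
  rw [← Finset.card_map ((Equiv.swap k l).prodCongr (Equiv.swap k l)).toEmbedding]
  apply Finset.card_lt_card
  rw [Finset.ssubset_iff_of_subset]
  · refine ⟨(k, l), by simp [hlt, hw], ?_⟩
    simp only [Finset.mem_map_equiv, Finset.mem_filter]
    simp [hlt.le]
  · rintro ⟨a, b⟩ h
    rw [Finset.mem_map_equiv, Finset.mem_filter] at h
    rw [Finset.mem_filter]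
    simp only [Finset.mem_univ, true_and, Equiv.prodCongr_symm, Equiv.symm_swap, Equiv.prodCongr_apply, Prod.map_apply,
      Equiv.Perm.mul_apply, Equiv.swap_apply_self] at h ⊢
    refine ⟨?_, h.2⟩
    have := swap_lt_swap_of_adjacent hkl h.1 ?_
    · simpa using this
    · rintro ⟨h1, h2⟩
      rw [Equiv.swap_apply_eq_iff, Equiv.swap_apply_left] at h1
      rw [Equiv.swap_apply_eq_iff, Equiv.swap_apply_right] at h2
      subst h1 h2
      exact absurd h.2 hw.not_gt

lemma bruhatLE_mul_swap_s7 {m : ℕ} {w : Equiv.Perm (Fin m)} {k l : Fin m}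
    (hkl : (l : ℕ) = k + 1) (hw : w l < w k) : bruhatLE (w * Equiv.swap k l) w := by
  refine Relation.ReflTransGen.single ⟨⟨w k, w l, hw.ne', ?_⟩, sLen_mul_swap_lt hkl hw⟩
  rw [← mul_assoc, Equiv.swap_apply_apply]
  simp [mul_assoc]

lemma bruhatLE.sLen_lt {m : ℕ} {u v : Equiv.Perm (Fin m)} (h : bruhatLE u v) (hne : u ≠ v) :
    sLen u < sLen v := by
  have key : u = v ∨ sLen u < sLen v := by
    clear hne
    induction h with
    | refl => exact Or.inl rfl
    | tail _ h ih =>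
      rcases ih with rfl | ih
      · exact Or.inr h.2
      · exact Or.inr (ih.trans h.2)
  exact key.resolve_left hne

lemma bruhatLE.antisymm {m : ℕ} {u v : Equiv.Perm (Fin m)} (h : bruhatLE u v)
    (h' : bruhatLE v u) : u = v := by
  by_contra hne
  exact (h.sLen_lt hne).asymm (h'.sLen_lt (Ne.symm hne))

namespace IsShuffle

variable {m : ℕ} {u w : Equiv.Perm (Fin m)} {i j k l : Fin m}

lemma two_le (h : IsShuffle w i j) (hi : k ≠ i) (hj : k ≠ j) : 2 ≤ (w k : ℕ) := by
  have h1 : (w k : ℕ) ≠ w i := fun e => hi (w.injective (Fin.ext e))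
  have h0 : (w k : ℕ) ≠ w j := fun e => hj (w.injective (Fin.ext e))
  have := h.map_one
  have := h.map_zero
  omega

lemma apply_lt (h : IsShuffle w i j) (hkl : k < l) (hi : k ≠ i) (hj : k ≠ j) : w l < w k := by
  by_contra hlt
  have hne : w k ≠ w l := fun e => hkl.ne (w.injective e)
  exact hkl.asymm (h.anti k l (h.two_le hi hj) (lt_of_le_of_ne (not_lt.mp hlt) hne))

protected lemma unique (hu : IsShuffle u i j) (hw : IsShuffle w i j) : u = w := by
  have hmono : StrictMono (w * u⁻¹) := by
    intro x y hxy
    obtain ⟨a, rfl⟩ := u.surjective x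
    obtain ⟨b, rfl⟩ := u.surjective y
    simp only [Equiv.Perm.coe_mul, Function.comp_apply, Equiv.Perm.coe_inv, Equiv.symm_apply_apply]
    have hu1 := hu.map_one
    have hu0 := hu.map_zero
    have hw1 := hw.map_one
    have hw0 := hw.map_zero
    rw [Fin.lt_def] at hxy
    rcases eq_or_ne a j with rfl | haj
    · have : b ≠ a := by rintro rfl; exact lt_irrefl _ hxy
      have : (w b : ℕ) ≠ w a := fun e => this (w.injective (Fin.ext e))
      rw [Fin.lt_def]; omega
    have hbj : b ≠ j := by rintro rfl; omega
    rcases eq_or_ne b i with rfl | hbi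
    · have : (u a : ℕ) ≠ u j := fun e => haj (u.injective (Fin.ext e))
      omega
    rcases eq_or_ne a i with rfl | hai
    · have := hw.two_le hbi hbj
      rw [Fin.lt_def]; omega
    · exact hw.apply_lt (hu.anti a b (hu.two_le hai haj) hxy) hbi hbj
  have hid : ⇑(w * u⁻¹) = id :=
    hmono.range_inj strictMono_id |>.mp (by simp)
  have : w * u⁻¹ = 1 := Equiv.ext fun x => congrFun hid x
  exact (mul_inv_eq_one.mp this).symm

lemma anti_mul_swap (h : IsShuffle w i j) (hkl : (l : ℕ) = k + 1) (hl : (w l : ℕ) < 2)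
    (a b : Fin m) (ha : 2 ≤ ((w * Equiv.swap k l) a : ℕ))
    (hab : (w * Equiv.swap k l) a < (w * Equiv.swap k l) b) : b < a := by
  have h1 := swap_lt_swap_of_adjacent hkl (h.anti _ _ ha hab) ?_
  · simpa using h1
  · rintro ⟨-, e⟩
    rw [Equiv.Perm.mul_apply, e] at ha
    omega

lemma mul_swap_left (h : IsShuffle w i j) (hki : (i : ℕ) = k + 1) :
    IsShuffle (w * Equiv.swap k i) k j := by
  have hij := h.lt
  have hjk : j ≠ k := by rintro rfl; rw [Fin.lt_def] at hij; omega
  refine ⟨by simpa using h.map_one, ?_, ?_, h.anti_mul_swap hki (by rw [h.map_one]; omega)⟩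
  · rw [Equiv.Perm.mul_apply, Equiv.swap_apply_of_ne_of_ne hjk hij.ne', h.map_zero]
  · rw [Fin.lt_def] at *; omega

lemma mul_swap_right (h : IsShuffle w i j) (hkj : (j : ℕ) = k + 1) (hik : i < k) :
    IsShuffle (w * Equiv.swap k j) i k := by
  refine ⟨?_, by simpa using h.map_zero, hik, h.anti_mul_swap hkj (by rw [h.map_zero]; omega)⟩
  rw [Equiv.Perm.mul_apply, Equiv.swap_apply_of_ne_of_ne hik.ne h.lt.ne, h.map_one]

lemma exists_bruhatLE (h : IsShuffle w i j) {i' j' : Fin m} (hi : i' ≤ i) (hj : j' ≤ j)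
    (hij' : i' < j') : ∃ v, IsShuffle v i' j' ∧ bruhatLE v w := by
  induction hN : (i + j : ℕ) generalizing w i j with
  | zero =>
    have := h.lt
    rw [Fin.lt_def] at this
    omega
  | succ N ih =>
    have hij := h.lt
    rw [Fin.le_def] at hi hj
    rw [Fin.lt_def] at hij hij'
    by_cases hii : (i' : ℕ) < i
    · let k : Fin m := ⟨i - 1, by omega⟩
      have hk : (i : ℕ) = k + 1 := by simp only [k]; omega
      have hki : k < i := by rw [Fin.lt_def]; omega
      have hkj : k < j := by rw [Fin.lt_def]; omega
      obtain ⟨v, hv, hle⟩ := ih (h.mul_swap_left hk) (by rw [Fin.le_def]; omega) hj (by omega)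
      exact ⟨v, hv, hle.trans (bruhatLE_mul_swap_s7 hk (h.apply_lt hki hki.ne hkj.ne))⟩
    by_cases hjj : (j' : ℕ) < j
    · let k : Fin m := ⟨j - 1, by omega⟩
      have hk : (j : ℕ) = k + 1 := by simp only [k]; omega
      have hik : i < k := by rw [Fin.lt_def]; omega
      have hkj : k < j := by rw [Fin.lt_def]; omega
      obtain ⟨v, hv, hle⟩ := ih (h.mul_swap_right hk hik) hi (by rw [Fin.le_def]; omega)
        (by omega)
      exact ⟨v, hv, hle.trans (bruhatLE_mul_swap_s7 hk (h.apply_lt hkj hik.ne' hkj.ne))⟩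
    · obtain rfl : i' = i := Fin.ext (by omega)
      obtain rfl : j' = j := Fin.ext (by omega)
      exact ⟨w, h, Relation.ReflTransGen.refl⟩

end IsShuffle

lemma exists_isShuffle {m : ℕ} {i j : Fin m} (hij : i < j) : ∃ w, IsShuffle w i j := by
  have := hij
  rw [Fin.lt_def] at this
  have hrev : IsShuffle (Fin.revPerm : Equiv.Perm (Fin m)) ⟨m - 2, by omega⟩
      ⟨m - 1, by omega⟩ := by
    refine ⟨?_, ?_, ?_, fun a b _ hab => Fin.rev_lt_rev.mp hab⟩
    · simp only [Fin.revPerm_apply, Fin.val_rev]; omega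
    · simp only [Fin.revPerm_apply, Fin.val_rev]; omega
    · rw [Fin.lt_def]; simp only; omega
  obtain ⟨w, hw, -⟩ := hrev.exists_bruhatLE (i' := i) (j' := j)
    (by rw [Fin.le_def]; simp only; omega) (by rw [Fin.le_def]; simp only; omega) hij
  exact ⟨w, hw⟩

/-- `R − {s_2} ⊆ Des (w⁻¹)` says exactly that `w` is a shuffle. -/
lemma compl_subset_Des_inv_iff {n : ℕ} (hn : 1 < n) {w : Equiv.Perm (Fin (n + 1))} :
    ({⟨1, hn⟩} : Set (Fin n))ᶜ ⊆ Des w⁻¹ ↔ ∃ i j, IsShuffle w i j := by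
  constructor
  · intro h
    have hstep : ∀ x : Fin n, (x : ℕ) ≠ 1 → w⁻¹ x.succ < w⁻¹ x.castSucc := fun x hx =>
      h (by simpa [Fin.ext_iff] using hx)
    have hanti : ∀ d : ℕ, ∀ x y : Fin (n + 1), 2 ≤ (x : ℕ) → (y : ℕ) = x + d + 1 →
        w⁻¹ y < w⁻¹ x := by
      intro d
      induction d with
      | zero =>
        intro x y hx hy
        have h' := hstep ⟨x, by omega⟩ (by simp only; omega)
        rwa [show y = Fin.succ ⟨x, by omega⟩ from Fin.ext hy]
      | succ d ih =>
        intro x y hx hy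
        refine lt_trans ?_ (ih x ⟨x + d + 1, by omega⟩ hx rfl)
        have h' := hstep ⟨x + d + 1, by omega⟩ (by simp only; omega)
        have hys : y = Fin.succ ⟨x + d + 1, by omega⟩ := Fin.ext hy
        exact (congrArg (⇑w⁻¹) hys).trans_lt h'
    refine ⟨w⁻¹ ⟨1, by omega⟩, w⁻¹ ⟨0, by omega⟩, by simp, by simp, ?_, ?_⟩
    · exact hstep ⟨0, by omega⟩ (by simp)
    · intro a b ha hab
      rw [Fin.lt_def] at hab
      simpa using hanti (w b - w a - 1) (w a) (w b) ha (by omega)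
  · rintro ⟨i, j, h⟩ x hx
    have hx1 : (x : ℕ) ≠ 1 := by simpa [Fin.ext_iff] using hx
    change w⁻¹ x.succ < w⁻¹ x.castSucc
    by_cases hx0 : (x : ℕ) = 0
    · have h1 : w⁻¹ x.succ = i := by
        rw [Equiv.Perm.inv_eq_iff_eq, Fin.ext_iff, h.map_one]; simp [hx0]
      have h0 : w⁻¹ x.castSucc = j := by
        rw [Equiv.Perm.inv_eq_iff_eq, Fin.ext_iff, h.map_zero]; simp [hx0]
      rw [h1, h0]
      exact h.lt
    · apply h.anti
      · simp; omega
      · simp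

lemma IsShuffle.mem_Des_iff {n : ℕ} {w : Equiv.Perm (Fin (n + 1))} {i j : Fin (n + 1)}
    (h : IsShuffle w i j) (x : Fin n) :
    x ∈ Des w ↔ (x : ℕ) ≠ j ∧ ((x : ℕ) = i → (j : ℕ) = x + 1) := by
  change w x.succ < w x.castSucc ↔ _
  have h1 := h.map_one
  have h0 := h.map_zero
  constructor
  · intro hx
    rw [Fin.lt_def] at hx
    refine ⟨fun e => ?_, fun e => ?_⟩
    · have : x.castSucc = j := Fin.ext e
      rw [this] at hx
      omega
    · have : x.castSucc = i := Fin.ext e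
      rw [this] at hx
      have : w x.succ = w j := Fin.ext (by omega)
      simp [← w.injective this]
  · rintro ⟨hj, hi⟩
    have hj' : x.castSucc ≠ j := fun e => hj (congrArg Fin.val e)
    by_cases e : (x : ℕ) = i
    · have ei : x.castSucc = i := Fin.ext e
      have ej : x.succ = j := Fin.ext (by simp [hi e])
      rw [ei, ej, Fin.lt_def]
      omega
    · exact h.apply_lt Fin.castSucc_lt_succ (fun e' => e (congrArg Fin.val e')) hj'


/-- Let `n ≥ 5`, `I = R − {s_2}`, `J = R − {s_2, s_q}` with `3 < q < n` (1-based),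
and let `τ₀ = (2, 1, n+1, n, ..., 3)` (the minimal element of `X⁺_{I,J}`).
Then exactly one element of `X⁺_{I,J}` covers `τ₀` in the restriction of the
Bruhat order to `X⁺_{I,J}`. -/
theorem stmt_7 (n : ℕ) (hn : 5 ≤ n) (q : ℕ) (hq1 : 3 < q) (hq2 : q < n)
    (I J : Set (Fin n))
    (hI : I = ({⟨1, by omega⟩} : Set (Fin n))ᶜ)
    (hJ : J = ({⟨1, by omega⟩, ⟨q - 1, by omega⟩} : Set (Fin n))ᶜ)
    (τ₀ : Equiv.Perm (Fin (n + 1)))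
    (hτ : (τ₀ ⟨0, by omega⟩ : ℕ) = 1 ∧ (τ₀ ⟨1, by omega⟩ : ℕ) = 0 ∧
      ∀ k : Fin (n + 1), 2 ≤ (k : ℕ) → (τ₀ k : ℕ) = n + 2 - (k : ℕ)) :
    ∃! τ₁ : Equiv.Perm (Fin (n + 1)), CoversIn (Xplus I J) τ₀ τ₁ := by
  subst hI hJ
  obtain ⟨h00, h01, h02⟩ := hτ
  have hτs : IsShuffle τ₀ ⟨0, by omega⟩ ⟨1, by omega⟩ := by
    refine ⟨h00, h01, by simp [Fin.lt_def], fun a b ha hab => ?_⟩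
    rw [Fin.lt_def] at hab ⊢
    have two_le : ∀ c : Fin (n + 1), 2 ≤ (τ₀ c : ℕ) → 2 ≤ (c : ℕ) := by
      intro c hc
      by_contra hlt
      obtain hc0 | hc1 : (c : ℕ) = 0 ∨ (c : ℕ) = 1 := by omega
      · rw [show c = ⟨0, by omega⟩ from Fin.ext hc0] at hc
        omega
      · rw [show c = ⟨1, by omega⟩ from Fin.ext hc1] at hc
        omega
    have := h02 a (two_le a ha)
    have := h02 b (two_le b (by omega))
    omega
  have mem_iff : ∀ w : Equiv.Perm (Fin (n + 1)),
      w ∈ Xplus ({⟨1, by omega⟩} : Set (Fin n))ᶜ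
        ({⟨1, by omega⟩, ⟨q - 1, by omega⟩} : Set (Fin n))ᶜ ↔
      ∃ i j, IsShuffle w i j ∧ ∀ x : ℕ, x < n → x ≠ 1 → x ≠ q - 1 →
        x ≠ j ∧ (x = i → (j : ℕ) = x + 1) := by
    intro w
    change _ ∧ _ ↔ _
    rw [compl_subset_Des_inv_iff]
    constructor
    · rintro ⟨⟨i, j, h⟩, hJ⟩
      refine ⟨i, j, h, fun x hx h1 hq => ?_⟩
      exact (h.mem_Des_iff ⟨x, hx⟩).mp (hJ (by simp [h1, hq]))
    · rintro ⟨i, j, h, hJ⟩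
      refine ⟨⟨i, j, h⟩, fun x hx => ?_⟩
      simp only [Set.mem_compl_iff, Set.mem_insert_iff, Set.mem_singleton_iff, Fin.ext_iff,
        not_or] at hx
      exact (h.mem_Des_iff x).mpr (hJ x x.2 hx.1 hx.2)
  obtain ⟨τ₁, hs⟩ := exists_isShuffle (m := n + 1) (i := ⟨1, by omega⟩)
    (j := ⟨q - 1, by omega⟩) (by simp [Fin.lt_def]; omega)
  have hτ₀X := (mem_iff τ₀).mpr ⟨_, _, hτs, fun x _ _ _ => by simp only; omega⟩
  have hτ₁X := (mem_iff τ₁).mpr ⟨_, _, hs, fun x _ _ _ => by simp only; omega⟩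
  have hle : bruhatLE τ₀ τ₁ := by
    obtain ⟨v, hv, hle⟩ := hs.exists_bruhatLE (i' := ⟨0, by omega⟩) (j' := ⟨1, by omega⟩)
      (by simp) (by simp [Fin.le_def]; omega) (by simp [Fin.lt_def])
    rwa [hτs.unique hv]
  have hne : τ₀ ≠ τ₁ := by
    rintro rfl
    have := congrArg Fin.val (τ₀.injective (Fin.ext (h00.trans hs.map_one.symm)))
    simp at this
  have hmin : ∀ w ∈ Xplus ({⟨1, by omega⟩} : Set (Fin n))ᶜ
      ({⟨1, by omega⟩, ⟨q - 1, by omega⟩} : Set (Fin n))ᶜ, w ≠ τ₀ → bruhatLE τ₁ w := by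
    intro w hw hwne
    obtain ⟨i, j, h, hJ⟩ := (mem_iff w).mp hw
    have hij := h.lt
    rw [Fin.lt_def] at hij
    have hj : (j : ℕ) = 1 ∨ (j : ℕ) = q - 1 ∨ (j : ℕ) = n := by
      by_contra! hj
      exact (hJ j (by omega) hj.1 hj.2.1).1 rfl
    have hj1 : (j : ℕ) ≠ 1 := by
      intro hj1
      obtain hi0 : i = ⟨0, by omega⟩ := Fin.ext (by simp only; omega)
      obtain hj0 : j = ⟨1, by omega⟩ := Fin.ext hj1
      rw [hi0, hj0] at h
      exact hwne (h.unique hτs)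
    have hi : 1 ≤ (i : ℕ) := by
      by_contra hi
      have := (hJ 0 (by omega) (by omega) (by omega)).2 (by omega)
      omega
    obtain ⟨v, hv, hle⟩ := h.exists_bruhatLE (i' := ⟨1, by omega⟩)
      (j' := ⟨q - 1, by omega⟩) (by rw [Fin.le_def]; exact hi)
      (by rw [Fin.le_def]; simp only; omega) (by simp [Fin.lt_def]; omega)
    rwa [hs.unique hv]
  refine ⟨τ₁, ⟨hτ₀X, hτ₁X, hle, hne, fun z hz _ hz1 => ?_⟩, ?_⟩
  · by_cases hz0 : z = τ₀
    · exact Or.inl hz0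
    · exact Or.inr (hz1.antisymm (hmin z hz hz0))
  · rintro y ⟨-, hyX, -, hy0, hy⟩
    exact ((hy τ₁ hτ₁X hle (hmin y hyX hy0.symm)).resolve_left hne.symm).symm
end
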